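/- Let n ≥ 1 and let ω ∈ ℂ be a primitive (n+1)-st root of unity; let σ be the ℂ-algebra automorphism of ℂ[x,y] with σ(x) = ωx and σ(y) = ω^{−1}y, so that the fixed subalgebra ℂ[x,y]^σ is spanned by the monomials x^a y^b with a ≡ b (mod n+1). Let I ⊆ ℂ[x,y] be a monomial ideal of finite codimension as a ℂ-vector space, and let λ(I) be the partition whose Young diagram is the set {(a,b) : x^a y^b ∉ I} of exponents of monomials outside I. Then I is generated, as an ideal of ℂ[x,y], by its invariant part I ∩ ℂ[x,y]^σ if and only if λ(I) is 0-generated. -/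

import Mathlib

/-- A partition: a weakly decreasing sequence of nonnegative integers with finitely
many nonzero terms. `parts i` denotes `λ_{i+1}` (0-indexed). -/
structure YPartition where
  parts : ℕ → ℕ
  antitone : ∀ ⦃i j : ℕ⦄, i ≤ j → parts j ≤ parts i
  finite_support : ∃ N : ℕ, ∀ i : ℕ, N ≤ i → parts i = 0

namespace YPartition

/-- The Young diagram `Y(λ) = {(i,j) : j < λ_{i+1}}`. -/
def diagram (l : YPartition) : Set (ℕ × ℕ) := {c : ℕ × ℕ | c.2 < l.parts c.1}

/-- The bead set (Maya diagram) `B(λ) = {λ_i − i + 1 : i = 1, 2, …} ⊆ ℤ`. -/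
def beadSet (l : YPartition) : Set ℤ := Set.range fun i : ℕ => (l.parts i : ℤ) - (i : ℤ)

/-- The total number of cells of the partition. -/
noncomputable def size (l : YPartition) : ℕ := l.diagram.ncard

/-- `wt n r l` is the number of cells `(i,j)` of `l` with `i − j ≡ r (mod n+1)`. -/
noncomputable def wt (n : ℕ) (r : ℤ) (l : YPartition) : ℕ :=
  {c : ℕ × ℕ | c ∈ l.diagram ∧ ((c.1 : ℤ) - (c.2 : ℤ)) ≡ r [ZMOD ((n : ℤ) + 1)]}.ncard

end YPartition

/-- A subset `S ⊆ ℤ` is balanced if `S ∩ ℤ_{>0}` and `ℤ_{≤0} ∖ S` are finite of the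
same cardinality. -/
def IsBalanced (S : Set ℤ) : Prop :=
  (S ∩ {p : ℤ | 0 < p}).Finite ∧ ({p : ℤ | p ≤ 0} \ S).Finite ∧
    (S ∩ {p : ℤ | 0 < p}).ncard = ({p : ℤ | p ≤ 0} \ S).ncard

/-- Two cells share an edge. -/
def CellAdj (p q : ℕ × ℕ) : Prop :=
  (p.1 = q.1 ∧ (p.2 + 1 = q.2 ∨ q.2 + 1 = p.2)) ∨
  (p.2 = q.2 ∧ (p.1 + 1 = q.1 ∨ q.1 + 1 = p.1))

/-- A set of cells is connected through shared edges. -/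
def CellConnected (S : Set (ℕ × ℕ)) : Prop :=
  ∀ p ∈ S, ∀ q ∈ S,
    Relation.ReflTransGen (fun a b => a ∈ S ∧ b ∈ S ∧ CellAdj a b) p q

/-- The set of cells contains no 2×2 square. -/
def NoTwoByTwo (S : Set (ℕ × ℕ)) : Prop :=
  ¬ ∃ i j : ℕ, (i, j) ∈ S ∧ (i + 1, j) ∈ S ∧ (i, j + 1) ∈ S ∧ (i + 1, j + 1) ∈ S

/-- A border strip of length `m`: exactly `m` cells, edge-connected, no 2×2 square. -/
def IsBorderStrip (S : Set (ℕ × ℕ)) (m : ℕ) : Prop :=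
  S.Finite ∧ S.ncard = m ∧ CellConnected S ∧ NoTwoByTwo S

/-- `l` is an `(n+1)`-core: no border strip of length `n+1` can be removed from it. -/
def IsCore (n : ℕ) (l : YPartition) : Prop :=
  ¬ ∃ m : YPartition, m.diagram ⊆ l.diagram ∧
      IsBorderStrip (l.diagram \ m.diagram) (n + 1)

/-- A cell `c ∉ Y(l)` is addable if `Y(l) ∪ {c}` is again a Young diagram. -/
def Addable (l : YPartition) (c : ℕ × ℕ) : Prop :=
  c ∉ l.diagram ∧ ∃ m : YPartition, m.diagram = l.diagram ∪ {c}

/-- `l` is 0-generated: every addable cell has content `≡ 0 (mod n+1)`. -/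
def ZeroGenerated (n : ℕ) (l : YPartition) : Prop :=
  ∀ c : ℕ × ℕ, Addable l c → ((c.1 : ℤ) - (c.2 : ℤ)) ≡ 0 [ZMOD ((n : ℤ) + 1)]

/-- The abacus parameter `a_r(λ)`: the number of positive beads congruent to `r`
minus the number of absent nonpositive positions congruent to `r` (mod `n+1`). -/
noncomputable def abacusParam (n : ℕ) (r : ℤ) (l : YPartition) : ℤ :=
  ({p : ℤ | p ∈ l.beadSet ∧ 0 < p ∧ p ≡ r [ZMOD ((n : ℤ) + 1)]}.ncard : ℤ) -
  ({p : ℤ | p ≤ 0 ∧ p ∉ l.beadSet ∧ p ≡ r [ZMOD ((n : ℤ) + 1)]}.ncard : ℤ)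

theorem exists_addable_le (l : YPartition) (a b : ℕ) (h : l.parts a ≤ b) :
    ∃ a' b', a' ≤ a ∧ b' ≤ b ∧ l.parts a' ≤ b' ∧ Addable l (a', b') := by
  classical
  have hex : ∃ k, l.parts k ≤ l.parts a := ⟨a, le_rfl⟩
  obtain ⟨k, hk, hmin⟩ : ∃ k, l.parts k ≤ l.parts a ∧ ∀ j < k, ¬ l.parts j ≤ l.parts a :=
    ⟨Nat.find hex, Nat.find_spec hex, fun j hj => Nat.find_min hex hj⟩
  have hka : k ≤ a := by
    by_contra hc
    exact hmin a (by omega) le_rfl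
  have hke : l.parts k = l.parts a := le_antisymm hk (l.antitone hka)
  refine ⟨k, l.parts a, hka, h, hk, ?_, ?_⟩
  · simp [YPartition.diagram, hke]
  · refine ⟨⟨Function.update l.parts k (l.parts a + 1), ?_, ?_⟩, ?_⟩
    · intro i j hij
      have hl := l.antitone hij
      by_cases hi : i = k
      · by_cases hj : j = k
        · simp [hi, hj]
        · subst hi
          simp [Function.update_of_ne hj]
          omega
      · by_cases hj : j = k
        · subst hj
          have := hmin i (by omega)
          simp [Function.update_of_ne hi]
          omega
        · simpa [Function.update_of_ne hi, Function.update_of_ne hj] using hl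
    · obtain ⟨N, hN⟩ := l.finite_support
      refine ⟨max N (k + 1), fun i hi => ?_⟩
      have : i ≠ k := by omega
      rw [Function.update_of_ne this]
      exact hN i (by omega)
    · ext ⟨i, j⟩
      by_cases hi : i = k
      · subst hi
        simp [YPartition.diagram, hke]
        omega
      · simp [YPartition.diagram, Function.update_of_ne hi, hi]

theorem addable_min (l : YPartition) (a b a' b' : ℕ) (h : Addable l (a, b)) (ha : a' ≤ a)
    (hb : b' ≤ b) (hn : (a', b') ∉ l.diagram) : a' = a ∧ b' = b := by
  obtain ⟨h1, m, hm⟩ := h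
  have hc : (a, b) ∈ m.diagram := by rw [hm]; simp
  have hc' : (a', b') ∈ m.diagram := by
    have := m.antitone ha
    simp only [YPartition.diagram, Set.mem_setOf_eq] at hc ⊢
    omega
  rw [hm] at hc'
  rcases hc' with hc' | hc'
  · exact absurd hc' hn
  · simpa using hc'

open MvPolynomial in
theorem coeff_sigma (ω : ℂ)
    (σ : MvPolynomial (Fin 2) ℂ →ₐ[ℂ] MvPolynomial (Fin 2) ℂ)
    (hσx : σ (X 0) = C ω * X 0) (hσy : σ (X 1) = C ω⁻¹ * X 1)
    (f : MvPolynomial (Fin 2) ℂ) (d : Fin 2 →₀ ℕ) :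
    coeff d (σ f) = (ω ^ d 0 * ω⁻¹ ^ d 1) * coeff d f := by
  classical
  have hmon : ∀ (e : Fin 2 →₀ ℕ) (c : ℂ),
      σ (monomial e c) = monomial e ((ω ^ e 0 * ω⁻¹ ^ e 1) * c) := by
    intro e c
    have h1 : ∀ c : ℂ, (monomial e c : MvPolynomial (Fin 2) ℂ) = C c * (X 0 ^ e 0 * X 1 ^ e 1) := by
      intro c
      rw [monomial_eq, Finsupp.prod_fintype _ _ (by simp)]
      simp [Fin.prod_univ_two]
    have h2 : σ (C c) = C c := σ.commutes c
    rw [h1, h1, map_mul, map_mul, map_pow, map_pow, hσx, hσy, h2]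
    simp only [map_mul, map_pow, mul_pow]
    ring
  induction f using MvPolynomial.induction_on' with
  | monomial e c =>
    rw [hmon, coeff_monomial, coeff_monomial]
    split_ifs with h
    · rw [h]
    · simp
  | add p q hp hq => rw [map_add, coeff_add, coeff_add, hp, hq]; ring

theorem omega_iff (n : ℕ) (ω : ℂ) (hω : IsPrimitiveRoot ω (n + 1)) (a b : ℕ) :
    ω ^ a * ω⁻¹ ^ b = 1 ↔ ((a : ℤ) - (b : ℤ)) ≡ 0 [ZMOD ((n : ℤ) + 1)] := by
  have h0 : ω ≠ 0 := hω.ne_zero (by omega)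
  have : ω ^ a * ω⁻¹ ^ b = ω ^ ((a : ℤ) - (b : ℤ)) := by
    rw [zpow_sub₀ h0]; simp [div_eq_mul_inv]
  rw [this, hω.zpow_eq_one_iff_dvd, Int.modEq_zero_iff_dvd]
  push_cast
  rfl

open MvPolynomial in
/-- a finite-colength monomial ideal `I ⊆ ℂ[x,y]` is generated by its
invariant part under `σ : x ↦ ωx, y ↦ ω⁻¹y` iff its partition is 0-generated. -/
theorem stmt11 (n : ℕ) (hn : 1 ≤ n) (ω : ℂ) (hω : IsPrimitiveRoot ω (n + 1))
    (σ : MvPolynomial (Fin 2) ℂ →ₐ[ℂ] MvPolynomial (Fin 2) ℂ)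
    (hσx : σ (X 0) = C ω * X 0) (hσy : σ (X 1) = C ω⁻¹ * X 1)
    (I : Ideal (MvPolynomial (Fin 2) ℂ))
    (hmono : ∃ S : Set (Fin 2 →₀ ℕ),
      I = Ideal.span ((fun d => (monomial d (1 : ℂ) : MvPolynomial (Fin 2) ℂ)) '' S))
    (hfin : FiniteDimensional ℂ (MvPolynomial (Fin 2) ℂ ⧸ I))
    (lam : YPartition)
    (hlam : ∀ a b : ℕ, ((a, b) ∈ lam.diagram ↔
      (monomial (Finsupp.single (0 : Fin 2) a + Finsupp.single (1 : Fin 2) b) (1 : ℂ)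
        : MvPolynomial (Fin 2) ℂ) ∉ I)) :
    I = Ideal.span {f : MvPolynomial (Fin 2) ℂ | f ∈ I ∧ σ f = f}
      ↔ ZeroGenerated n lam := by
  classical
  have hd : ∀ d : Fin 2 →₀ ℕ,
      Finsupp.single (0 : Fin 2) (d 0) + Finsupp.single (1 : Fin 2) (d 1) = d := by
    intro d
    ext i
    fin_cases i <;> simp
  have hlam' : ∀ d : Fin 2 →₀ ℕ, (d 0, d 1) ∉ lam.diagram ↔
      (monomial d (1 : ℂ) : MvPolynomial (Fin 2) ℂ) ∈ I := by
    intro d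
    rw [hlam, hd, not_not]
  have hsupp : ∀ f ∈ I, ∀ d ∈ f.support, (monomial d (1 : ℂ) : MvPolynomial (Fin 2) ℂ) ∈ I := by
    obtain ⟨S, hS⟩ := hmono
    intro f hf d hdf
    rw [hS] at hf ⊢
    rw [mem_ideal_span_monomial_image] at hf ⊢
    intro e he
    have : e = d := by
      by_contra hne
      simp [coeff_monomial, Ne.symm hne] at he
    rw [this]
    exact hf d hdf
  have hinv : ∀ f, σ f = f → ∀ d ∈ f.support,
      ((d 0 : ℤ) - (d 1 : ℤ)) ≡ 0 [ZMOD ((n : ℤ) + 1)] := by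
    intro f hf d hdf
    have h1 := coeff_sigma ω σ hσx hσy f d
    rw [hf] at h1
    rw [← omega_iff n ω hω]
    exact mul_right_cancel₀ (mem_support_iff.mp hdf) (by rw [one_mul, ← h1])
  have hspan : Ideal.span {f : MvPolynomial (Fin 2) ℂ | f ∈ I ∧ σ f = f} =
      Ideal.span ((fun d => (monomial d (1 : ℂ) : MvPolynomial (Fin 2) ℂ)) ''
        {d | (monomial d (1 : ℂ) : MvPolynomial (Fin 2) ℂ) ∈ I ∧
          ((d 0 : ℤ) - (d 1 : ℤ)) ≡ 0 [ZMOD ((n : ℤ) + 1)]}) := by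
    apply le_antisymm
    · rw [Ideal.span_le]
      rintro f ⟨hf, hσf⟩
      rw [SetLike.mem_coe, mem_ideal_span_monomial_image]
      intro d hdf
      exact ⟨d, ⟨hsupp f hf d hdf, hinv f hσf d hdf⟩, le_rfl⟩
    · apply Ideal.span_mono
      rintro _ ⟨d, ⟨h1, h2⟩, rfl⟩
      refine ⟨h1, ?_⟩
      ext e
      rw [coeff_sigma ω σ hσx hσy, coeff_monomial]
      split_ifs with h
      · rw [← h, (omega_iff n ω hω _ _).2 h2, one_mul]
      · simp
  rw [hspan]
  constructor
  · rintro hI ⟨a, b⟩ hc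
    have hm := (not_congr (hlam a b)).1 hc.1
    rw [not_not, hI, mem_ideal_span_monomial_image] at hm
    obtain ⟨d, ⟨h1, h2⟩, h3⟩ := hm (Finsupp.single 0 a + Finsupp.single 1 b) (by simp)
    have ha : d 0 ≤ a := by simpa using h3 0
    have hb : d 1 ≤ b := by simpa using h3 1
    obtain ⟨e1, e2⟩ := addable_min lam a b _ _ hc ha hb ((hlam' d).2 h1)
    rw [e1, e2] at h2
    exact h2
  · intro hz
    apply le_antisymm
    · intro f hf
      rw [mem_ideal_span_monomial_image]
      intro d hdf
      have h1 := (hlam' d).2 (hsupp f hf d hdf)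
      obtain ⟨a, b, ha, hb, -, hadd⟩ := exists_addable_le lam (d 0) (d 1)
        (by simpa [YPartition.diagram] using h1)
      refine ⟨Finsupp.single 0 a + Finsupp.single 1 b, ⟨?_, ?_⟩, ?_⟩
      · have := (not_congr (hlam a b)).1 hadd.1
        rwa [not_not] at this
      · simpa using hz _ hadd
      · intro i
        fin_cases i
        · simpa using ha
        · simpa using hb
    · rw [Ideal.span_le]
      rintro _ ⟨d, ⟨h1, h2⟩, rfl⟩
      exact h1
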